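/- The approximate characteristic curves converge almost everywhere: Γ^{(N)}(ω; 0; x, t) → Γ(ω; 0; x, t) as N → ∞ for (P ⊗ λ)-almost every (ω, x, t) ∈ Ω × ℝ². -/

import Mathlib

open Filter Topology MeasureTheory Set

/-- Generalized inverse: `geninv f x = inf {t : f t ≥ x}`. -/
noncomputable def geninv (f : ℝ → ℝ) (x : ℝ) : ℝ := sInf {t : ℝ | x ≤ f t}

/-- Piecewise affine interpolation of `ξ` through the dyadic grid points
`(k/2^N, ξ(k/2^N))`, `k ∈ ℤ`. -/
noncomputable def dyadicInterp (ξ : ℝ → ℝ) (N : ℕ) (s : ℝ) : ℝ :=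
  (((⌈s * 2 ^ N⌉ : ℤ) : ℝ) / 2 ^ N - s) * 2 ^ N
      * ξ ((((⌈s * 2 ^ N⌉ : ℤ) : ℝ) - 1) / 2 ^ N)
    + (1 - (((⌈s * 2 ^ N⌉ : ℤ) : ℝ) / 2 ^ N - s) * 2 ^ N)
      * ξ (((⌈s * 2 ^ N⌉ : ℤ) : ℝ) / 2 ^ N)

/-- A nondecreasing right-continuous path tending to `±∞` at `±∞`. -/
structure IsIncreasingPath (ξ : ℝ → ℝ) : Prop where
  mono : Monotone ξ
  right_cont : ∀ s, ContinuousWithinAt ξ (Ici s) s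
  tendsto_atTop : Tendsto ξ atTop atTop
  tendsto_atBot : Tendsto ξ atBot atBot

theorem isIncreasingPath_id : IsIncreasingPath (fun t => t) :=
  ⟨monotone_id, fun _ => continuousWithinAt_id, tendsto_id, tendsto_id⟩

theorem IsIncreasingPath.geninv_le_iff {ξ : ℝ → ℝ} (hξ : IsIncreasingPath ξ) {x a : ℝ} :
    geninv ξ x ≤ a ↔ x ≤ ξ a := by
  constructor
  · intro h
    by_contra! hlt
    obtain ⟨u, hau, hu⟩ :=
      (mem_nhdsGE_iff_exists_Ico_subset).1 ((hξ.right_cont a).eventually_lt_const hlt)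
    have hne : {t : ℝ | x ≤ ξ t}.Nonempty := (hξ.tendsto_atTop.eventually_ge_atTop x).exists
    have : u ≤ geninv ξ x := by
      refine le_csInf hne fun t ht => ?_
      by_contra! htu
      rcases le_total a t with hat | hta
      · exact (lt_irrefl x) (lt_of_le_of_lt ht (hu ⟨hat, htu⟩))
      · exact absurd (hξ.mono hta) (not_le.2 (hlt.trans_le ht))
    exact absurd (this.trans h) (not_le.2 hau)
  · intro h
    obtain ⟨b, hb⟩ := (hξ.tendsto_atBot.eventually_lt_atBot x).exists
    refine csInf_le ⟨b, fun t ht => ?_⟩ h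
    by_contra! htb
    exact absurd (hξ.mono htb.le) (not_le.2 (hb.trans_le ht))

theorem dyadicInterp_mem_Icc {ξ : ℝ → ℝ} (hξ : Monotone ξ) (N : ℕ) (s : ℝ) :
    dyadicInterp ξ N s ∈ Icc (ξ (s - 1 / 2 ^ N)) (ξ (s + 1 / 2 ^ N)) := by
  have hpos : (0 : ℝ) < 2 ^ N := by positivity
  unfold dyadicInterp
  have hc := Int.le_ceil (s * 2 ^ N)
  have hc' := Int.ceil_lt_add_one (s * 2 ^ N)
  generalize ((⌈s * 2 ^ N⌉ : ℤ) : ℝ) = c at hc hc' ⊢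
  have hw : (c / 2 ^ N - s) * 2 ^ N = c - s * 2 ^ N := by field_simp
  rw [hw]
  have h1 : ξ (s - 1 / 2 ^ N) ≤ ξ ((c - 1) / 2 ^ N) := by
    apply hξ
    rw [le_div_iff₀ hpos, sub_mul, div_mul_cancel₀ _ hpos.ne']
    linarith
  have h2 : ξ (c / 2 ^ N) ≤ ξ (s + 1 / 2 ^ N) := by
    apply hξ
    rw [div_le_iff₀ hpos, add_mul, div_mul_cancel₀ _ hpos.ne']
    linarith
  have h3 : ξ ((c - 1) / 2 ^ N) ≤ ξ (c / 2 ^ N) := by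
    apply hξ
    gcongr
    linarith
  constructor <;> nlinarith

theorem IsIncreasingPath.abs_geninv_dyadicInterp_sub_le {ξ : ℝ → ℝ} (hξ : IsIncreasingPath ξ)
    (N : ℕ) (x : ℝ) :
    |geninv (dyadicInterp ξ N) x - geninv ξ x| ≤ 1 / 2 ^ N := by
  have hmem : x ≤ dyadicInterp ξ N (geninv ξ x + 1 / 2 ^ N) := by
    have := (dyadicInterp_mem_Icc hξ.mono N (geninv ξ x + 1 / 2 ^ N)).1
    rw [add_sub_cancel_right] at this
    exact (hξ.geninv_le_iff.1 le_rfl).trans this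
  have hlb : ∀ t ∈ {t : ℝ | x ≤ dyadicInterp ξ N t}, geninv ξ x - 1 / 2 ^ N ≤ t := by
    intro t ht
    have := hξ.geninv_le_iff.2 (le_trans ht (dyadicInterp_mem_Icc hξ.mono N t).2)
    linarith
  have hle : geninv (dyadicInterp ξ N) x ≤ geninv ξ x + 1 / 2 ^ N := csInf_le ⟨_, hlb⟩ hmem
  have hge : geninv ξ x - 1 / 2 ^ N ≤ geninv (dyadicInterp ξ N) x := le_csInf ⟨_, hmem⟩ hlb
  rw [abs_le]
  constructor <;> linarith

theorem tendsto_one_div_two_pow : Tendsto (fun N : ℕ => (1 : ℝ) / 2 ^ N) atTop (𝓝 0) := by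
  simpa only [one_div, inv_pow] using
    tendsto_pow_atTop_nhds_zero_of_lt_one (r := (2 : ℝ)⁻¹) (by norm_num) (by norm_num)

theorem IsIncreasingPath.tendsto_geninv_dyadicInterp {ξ : ℝ → ℝ} (hξ : IsIncreasingPath ξ)
    (x : ℝ) :
    Tendsto (fun N => geninv (dyadicInterp ξ N) x) atTop (𝓝 (geninv ξ x)) := by
  rw [tendsto_iff_dist_tendsto_zero]
  exact squeeze_zero (fun _ => dist_nonneg)
    (fun N => hξ.abs_geninv_dyadicInterp_sub_le N x) tendsto_one_div_two_pow

theorem tendsto_dyadicInterp_of_continuousAt {ξ : ℝ → ℝ} (hξ : Monotone ξ) {s : ℝ}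
    (hs : ContinuousAt ξ s) {u : ℕ → ℝ} (hu : Tendsto u atTop (𝓝 s)) :
    Tendsto (fun N => dyadicInterp ξ N (u N)) atTop (𝓝 (ξ s)) := by
  have hlo : Tendsto (fun N : ℕ => u N - 1 / 2 ^ N) atTop (𝓝 s) := by
    simpa using hu.sub tendsto_one_div_two_pow
  have hhi : Tendsto (fun N : ℕ => u N + 1 / 2 ^ N) atTop (𝓝 s) := by
    simpa using hu.add tendsto_one_div_two_pow
  exact tendsto_of_tendsto_of_tendsto_of_le_of_le (hs.tendsto.comp hlo) (hs.tendsto.comp hhi)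
    (fun N => (dyadicInterp_mem_Icc hξ N (u N)).1) (fun N => (dyadicInterp_mem_Icc hξ N (u N)).2)

theorem IsIncreasingPath.continuousAt_iff {ξ : ℝ → ℝ} (hξ : IsIncreasingPath ξ) {s : ℝ} :
    ContinuousAt ξ s ↔ Tendsto (fun N : ℕ => ξ (s - 1 / 2 ^ N)) atTop (𝓝 (ξ s)) := by
  constructor
  · intro h
    refine h.tendsto.comp ?_
    simpa using tendsto_const_nhds.sub tendsto_one_div_two_pow
  · intro h
    refine continuousAt_iff_continuous_left'_right'.2
      ⟨?_, (hξ.right_cont s).mono Ioi_subset_Ici_self⟩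
    refine tendsto_order.2 ⟨fun a ha => ?_, fun a ha => ?_⟩
    · obtain ⟨N, hN⟩ := (h.eventually_const_lt ha).exists
      have hlt : s - 1 / 2 ^ N < s := by
        have : (0 : ℝ) < 1 / 2 ^ N := by positivity
        linarith
      filter_upwards [Ioo_mem_nhdsLT hlt] with t ht
      exact hN.trans_le (hξ.mono ht.1.le)
    · filter_upwards [self_mem_nhdsWithin] with t ht
      exact (hξ.mono (le_of_lt ht)).trans_lt ha

section Measurability

variable {Ω : Type*} [MeasurableSpace Ω] {X : Ω × ℝ → ℝ}

theorem measurable_geninv (hX : Measurable X)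
    (hpath : ∀ ω, IsIncreasingPath (fun t => X (ω, t))) :
    Measurable (fun p : Ω × ℝ => geninv (fun t => X (p.1, t)) p.2) := by
  refine measurable_of_Iic fun a => ?_
  have : (fun p : Ω × ℝ => geninv (fun t => X (p.1, t)) p.2) ⁻¹' Iic a
      = {p : Ω × ℝ | p.2 ≤ X (p.1, a)} := by
    ext p
    exact (hpath p.1).geninv_le_iff
  rw [this]
  exact measurableSet_le measurable_snd (hX.comp (measurable_fst.prodMk measurable_const))

theorem measurableSet_continuousAt (hX : Measurable X)
    (hpath : ∀ ω, IsIncreasingPath (fun t => X (ω, t))) :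
    MeasurableSet {p : Ω × ℝ | ContinuousAt (fun t => X (p.1, t)) p.2} := by
  simp only [fun p : Ω × ℝ => (hpath p.1).continuousAt_iff (s := p.2)]
  exact measurableSet_tendsto_fun
    (fun N => hX.comp (measurable_fst.prodMk (measurable_snd.sub measurable_const))) hX

theorem ae_continuousAt_geninv_sub (P : Measure Ω) [SFinite P] (hX : Measurable X)
    (hpath : ∀ ω, IsIncreasingPath (fun t => X (ω, t))) :
    ∀ᵐ p : Ω × (ℝ × ℝ) ∂(P.prod (volume : Measure (ℝ × ℝ))),
      ContinuousAt (fun t => X (p.1, t)) (geninv (fun t => X (p.1, t)) p.2.1 - p.2.2) := by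
  have hmeas : MeasurableSet {p : Ω × (ℝ × ℝ) |
      ContinuousAt (fun t => X (p.1, t)) (geninv (fun t => X (p.1, t)) p.2.1 - p.2.2)} := by
    have hshift : Measurable (fun p : Ω × (ℝ × ℝ) =>
        (p.1, geninv (fun t => X (p.1, t)) p.2.1 - p.2.2)) :=
      measurable_fst.prodMk
        (((measurable_geninv hX hpath).comp
          (measurable_fst.prodMk (measurable_fst.comp measurable_snd))).sub
          (measurable_snd.comp measurable_snd))
    exact hshift (measurableSet_continuousAt hX hpath)
  refine (Measure.ae_prod_iff_ae_ae hmeas).2 (ae_of_all _ fun ω => ?_)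
  refine (Measure.ae_prod_iff_ae_ae (measurable_prodMk_left hmeas)).2 (ae_of_all _ fun x => ?_)
  refine Set.Countable.measure_zero ?_ volume
  exact (hpath ω).mono.countable_not_continuousAt.preimage
    (sub_right_injective (b := geninv (fun t => X (ω, t)) x))

end Measurability

/-- the approximate characteristic curves converge almost everywhere:
`Γ^{(N)}(ω; 0; x, t) → Γ(ω; 0; x, t)` as `N → ∞`, for `(P ⊗ λ)`-almost every
`(ω, x, t) ∈ Ω × ℝ²`. -/
theorem stmt10 {Ω : Type*} [MeasurableSpace Ω] (P : Measure Ω) [IsProbabilityMeasure P]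
    (X : Ω × ℝ → ℝ) (hX : Measurable X)
    (hnice : ∀ᵐ ω ∂P,
      StrictMono (fun t => X (ω, t)) ∧
      (∀ s : ℝ, ContinuousWithinAt (fun t => X (ω, t)) (Set.Ici s) s) ∧
      (∀ s : ℝ, ∃ L : ℝ, Tendsto (fun t => X (ω, t)) (𝓝[<] s) (𝓝 L)) ∧
      Tendsto (fun t => X (ω, t)) atTop atTop ∧
      Tendsto (fun t => X (ω, t)) atBot atBot) :
    ∀ᵐ p : Ω × (ℝ × ℝ) ∂(P.prod (volume : Measure (ℝ × ℝ))),
      Tendsto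
        (fun N : ℕ =>
          dyadicInterp (fun s => X (p.1, s)) N
            (0 + geninv (dyadicInterp (fun s => X (p.1, s)) N) p.2.1 - p.2.2))
        atTop
        (𝓝 (X (p.1, 0 + geninv (fun s => X (p.1, s)) p.2.1 - p.2.2))) := by
  classical
  obtain ⟨A, hAnice, hAm, hPA⟩ := exists_measurable_superset_of_null (ae_iff.1 hnice)
  let Y : Ω × ℝ → ℝ := fun p => if p.1 ∈ A then p.2 else X p
  have hY : Measurable Y := Measurable.ite (measurable_fst hAm) measurable_snd hX
  have hpath : ∀ ω, IsIncreasingPath (fun t => Y (ω, t)) := by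
    intro ω
    by_cases hω : ω ∈ A
    · simpa [Y, hω] using isIncreasingPath_id
    · obtain ⟨hm, hr, -, ht, hb⟩ := not_not.1 fun h => hω (hAnice h)
      simpa [Y, hω] using IsIncreasingPath.mk hm.monotone hr ht hb
  have hnot : ∀ᵐ ω ∂P, ω ∉ A := measure_eq_zero_iff_ae_notMem.1 hPA
  filter_upwards [Measure.quasiMeasurePreserving_fst.ae hnot,
    ae_continuousAt_geninv_sub P hY hpath] with p hp hcont
  have hξ := hpath p.1
  simp only [Y, hp, if_false] at hcont hξ
  simp only [zero_add]
  exact tendsto_dyadicInterp_of_continuousAt hξ.mono hcont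
    ((hξ.tendsto_geninv_dyadicInterp p.2.1).sub_const p.2.2)
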